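/- arXiv:2008.02998 — 2 statements merged into one kernel-verified Lean document; each statement's English description precedes it below -/
import Mathlib

section
/- Let Γ be a finite group, A a commutative ring in which the order of Γ is invertible, and I ⊆ A an ideal with I² = 0. Then every group homomorphism ρ̄ : Γ → GL_n(A/I) lifts to a group homomorphism ρ : Γ → GL_n(A), i.e. the map Hom(Γ, GL_n(A)) → Hom(Γ, GL_n(A/I)) induced by reduction modulo I is surjective. -/
/-- Lifting units along a surjection with square-zero kernel. -/
theorem lift_unit_aux {R S : Type*} [Ring R] [Ring S] (f : R →+* S)
    (hf : Function.Surjective f) (hK : ∀ x y, f x = 0 → f y = 0 → x * y = 0) (v : Sˣ) :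
    ∃ u : Rˣ, f u = v := by
  obtain ⟨s, hs⟩ := hf v
  obtain ⟨t, ht⟩ := hf (v⁻¹ : Sˣ)
  have h1 : (s * t - 1) * (s * t - 1) = 0 := hK _ _ (by simp [hs, ht]) (by simp [hs, ht])
  have h2 : (t * s - 1) * (t * s - 1) = 0 := hK _ _ (by simp [hs, ht]) (by simp [hs, ht])
  have hu : IsUnit s := by
    rw [isUnit_iff_exists_and_exists]
    refine ⟨⟨t * (2 - s * t), ?_⟩, ⟨(2 - t * s) * t, ?_⟩⟩
    · have : s * (t * (2 - s * t)) = 1 - (s * t - 1) * (s * t - 1) := by noncomm_ring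
      rw [this, h1, sub_zero]
    · have : (2 - t * s) * t * s = 1 - (t * s - 1) * (t * s - 1) := by noncomm_ring
      rw [this, h2, sub_zero]
  exact ⟨hu.unit, hs⟩

/-- Lifting homomorphisms from a finite group of invertible order along a surjection with
square-zero kernel: average `u (g h) (u h)⁻¹` over `h`. -/
theorem lift_hom_aux {R S Γ : Type*} [Ring R] [Ring S] [Group Γ] [Fintype Γ] (f : R →+* S)
    (hf : Function.Surjective f) (hK : ∀ x y, f x = 0 → f y = 0 → x * y = 0)
    (hcard : IsUnit (Fintype.card Γ : R)) (ρbar : Γ →* Sˣ) :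
    ∃ ρ : Γ →* Rˣ, ∀ g, f (ρ g) = ρbar g := by
  choose u hu using fun g => lift_unit_aux f hf hK (ρbar g)
  obtain ⟨N, hN⟩ := hcard
  let T : Γ → Γ → R := fun g h => ((u (g * h) * (u h)⁻¹ : Rˣ) : R)
  have hTm : ∀ g h k, T g (h * k) * T h k = T (g * h) k := by
    intro g h k
    simp only [T, ← Units.val_mul]
    congr 1
    simp [mul_assoc]
  have hT1 : ∀ k, T 1 k = 1 := by intro k; simp [T]
  have hU : ∀ g, Units.map (f : R →* S) (u g) = ρbar g := fun g => Units.ext (hu g)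
  have hfT : ∀ g h, f (T g h) = ρbar g := by
    intro g h
    have : Units.map (f : R →* S) (u (g * h) * (u h)⁻¹) = ρbar g := by
      rw [map_mul, map_inv, hU, hU, map_mul, mul_inv_cancel_right]
    exact congrArg Units.val this
  let r : Γ → R := fun g => (↑N⁻¹ : R) * ∑ h, T g h
  have hsum : ∀ g, ∑ h, T g h = (Fintype.card Γ : R) * r g := by
    intro g; simp only [r]; rw [← hN, Units.mul_inv_cancel_left]
  have hr1 : r 1 = 1 := by
    simp only [r, hT1]; simp [← hN]
  have hfr : ∀ g, f (r g) = ρbar g := by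
    intro g
    have h1 : f (↑N⁻¹ : R) * (Fintype.card Γ : S) = 1 := by
      rw [← map_natCast f, ← map_mul, ← hN]; simp
    simp only [r, map_mul, map_sum, hfT, Finset.sum_const, Finset.card_univ, nsmul_eq_mul]
    rw [← mul_assoc, h1, one_mul]
  have hrm : ∀ g h, r (g * h) = r g * r h := by
    intro g h
    have h0 : ∑ k, (T g (h * k) - r g) * (T h k - r h) = 0 :=
      Finset.sum_eq_zero fun k _ => hK _ _ (by simp [hfT, hfr]) (by simp [hfT, hfr])
    have hre : ∑ k, T g (h * k) = ∑ k, T g k :=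
      Fintype.sum_equiv (Equiv.mulLeft h) _ _ (fun _ => rfl)
    simp only [sub_mul, mul_sub, Finset.sum_sub_distrib, hTm, ← Finset.sum_mul,
      ← Finset.mul_sum, hre, hsum, Finset.sum_const, Finset.card_univ, nsmul_eq_mul] at h0
    have hc : r g * ((Fintype.card Γ : R) * r h) = (Fintype.card Γ : R) * (r g * r h) := by
      rw [← mul_assoc, ← (Nat.cast_commute (Fintype.card Γ) (r g)).eq, mul_assoc]
    rw [hc, mul_assoc, sub_self, sub_zero, ← mul_sub, ← hN, Units.mul_right_eq_zero] at h0
    rw [← mul_assoc] at h0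
    exact sub_eq_zero.mp h0
  let ρ : Γ →* R := { toFun := r, map_one' := hr1, map_mul' := hrm }
  exact ⟨ρ.toHomUnits, fun g => hfr g⟩

/-- Let `Γ` be a finite group, `A` a commutative ring in which `#Γ` is invertible, and
`I ⊆ A` an ideal with `I² = 0`.  Then every group homomorphism `Γ → GL_n(A/I)` lifts to a
group homomorphism `Γ → GL_n(A)`: the map `Hom(Γ, GL_n(A)) → Hom(Γ, GL_n(A/I))` induced by
reduction modulo `I` is surjective. -/
theorem stmt7 {A : Type*} [CommRing A] (Γ : Type*) [Group Γ] [Fintype Γ]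
    (hcard : IsUnit (Fintype.card Γ : A)) (n : ℕ) (I : Ideal A) (hI : I ^ 2 = ⊥)
    (ρbar : Γ →* (Matrix (Fin n) (Fin n) (A ⧸ I))ˣ) :
    ∃ ρ : Γ →* (Matrix (Fin n) (Fin n) A)ˣ,
      (Units.map ((Ideal.Quotient.mk I).mapMatrix.toMonoidHom :
          Matrix (Fin n) (Fin n) A →* Matrix (Fin n) (Fin n) (A ⧸ I))).comp ρ = ρbar := by
  suffices h : ∃ ρ : Γ →* (Matrix (Fin n) (Fin n) A)ˣ,
      ∀ g, (Ideal.Quotient.mk I).mapMatrix (ρ g : Matrix (Fin n) (Fin n) A) = ρbar g by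
    obtain ⟨ρ, hρ⟩ := h
    exact ⟨ρ, MonoidHom.ext fun g => Units.ext (hρ g)⟩
  refine lift_hom_aux (Γ := Γ) ((Ideal.Quotient.mk I).mapMatrix (m := Fin n)) ?_ ?_ ?_ ρbar
  · intro M
    choose a ha using fun i j => Ideal.Quotient.mk_surjective (M i j)
    exact ⟨Matrix.of a, by ext i j; simp [ha]⟩
  · intro x y hx hy
    ext i j
    rw [Matrix.mul_apply]
    refine Finset.sum_eq_zero fun k _ => ?_
    have h1 : x i k ∈ I := Ideal.Quotient.eq_zero_iff_mem.mp (congrFun (congrFun hx i) k)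
    have h2 : y k j ∈ I := Ideal.Quotient.eq_zero_iff_mem.mp (congrFun (congrFun hy k) j)
    have h3 := Ideal.mul_mem_mul h1 h2
    rwa [← pow_two, hI, Ideal.mem_bot] at h3
  · have := hcard.map (algebraMap A (Matrix (Fin n) (Fin n) A))
    rwa [map_natCast] at this
end

section
/- Let K be an algebraically closed field, m ≥ 1, and q ≥ 2 an integer. Then the set of conjugacy classes of elements g ∈ GL_m(K) satisfying charpoly(g^q) = charpoly(g) is finite. -/
open Polynomial Module

theorem aux_roots {K : Type*} [Field K] (m q : ℕ) (S : Finset K) (hS : S.card ≤ m)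
    (h : ∀ x ∈ S, x ^ q ∈ S) (x : K) (hx : x ∈ S) :
    ∃ i j, i < j ∧ j ≤ m ∧ x ^ q ^ j = x ^ q ^ i := by
  have hmem : ∀ i, x ^ q ^ i ∈ S := by
    intro i
    induction i with
    | zero => simpa using hx
    | succ n ih => rw [pow_succ, pow_mul]; exact h _ ih
  obtain ⟨i, hi, j, hj, hne, he⟩ := Finset.exists_ne_map_eq_of_card_lt_of_maps_to
    (s := Finset.range (m + 1)) (t := S) (by simp; omega) (f := fun i => x ^ q ^ i)
    (fun i _ => hmem i)
  simp only [Finset.mem_range] at hi hj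
  rcases lt_or_gt_of_ne hne with hl | hl
  · exact ⟨i, j, hl, by omega, he.symm⟩
  · exact ⟨j, i, hl, by omega, he⟩

/-- A fixed polynomial killing every matrix in question. -/
noncomputable def auxP (K : Type*) [Field K] (m q : ℕ) : K[X] :=
  (∏ j ∈ Finset.range (m + 1), ∏ i ∈ Finset.range j, (X ^ q ^ j - X ^ q ^ i)) ^ m

theorem auxP_ne_zero (K : Type*) [Field K] (m q : ℕ) (hq : 2 ≤ q) : auxP K m q ≠ 0 := by
  refine pow_ne_zero _ (Finset.prod_ne_zero_iff.2 fun j _ => Finset.prod_ne_zero_iff.2 ?_)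
  intro i hi h
  have h1 := sub_eq_zero.1 h
  have h2 := congrArg natDegree h1
  simp only [natDegree_X_pow] at h2
  have := Nat.pow_right_injective hq h2
  simp at hi
  omega

theorem aeval_auxP {K : Type*} [Field K] [IsAlgClosed K] (m q : ℕ)
    (g : Matrix (Fin m) (Fin m) K) (hg : (g ^ q).charpoly = g.charpoly) :
    aeval g (auxP K m q) = 0 := by
  classical
  have hdeg : g.charpoly.natDegree = m := by simp [Matrix.charpoly_natDegree_eq_dim]
  have hs := IsAlgClosed.splits g.charpoly
  have hcard : Multiset.card g.charpoly.roots = m := by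
    rw [← hs.natDegree_eq_card_roots, hdeg]
  have hne : g.charpoly ≠ 0 := g.charpoly_monic.ne_zero
  have key : ∀ x ∈ g.charpoly.roots,
      X - C x ∣ ∏ j ∈ Finset.range (m + 1), ∏ i ∈ Finset.range j,
        ((X : K[X]) ^ q ^ j - X ^ q ^ i) := by
    intro x hx
    obtain ⟨i, j, hij, hj, he⟩ := aux_roots m q g.charpoly.roots.toFinset
      ((Multiset.toFinset_card_le _).trans hcard.le) (by
        intro y hy
        simp only [Multiset.mem_toFinset, mem_roots hne] at hy ⊢
        rw [← Matrix.mem_spectrum_iff_isRoot_charpoly] at hy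
        rw [← hg, ← Matrix.mem_spectrum_iff_isRoot_charpoly]
        exact spectrum.pow_mem_pow _ _ hy) x (by simpa using hx)
    refine dvd_trans ?_ (Finset.dvd_prod_of_mem _ (Finset.mem_range.2 (Nat.lt_succ_of_le hj)))
    refine dvd_trans ?_ (Finset.dvd_prod_of_mem _ (Finset.mem_range.2 hij))
    rw [dvd_iff_isRoot]
    simp [he]
  have hd : g.charpoly ∣ auxP K m q := by
    rw [hs.eq_prod_roots_of_monic g.charpoly_monic, auxP]
    generalize (∏ j ∈ Finset.range (m + 1), ∏ i ∈ Finset.range j,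
        ((X : K[X]) ^ q ^ j - X ^ q ^ i)) = Q at key ⊢
    conv_rhs => rw [← hcard]
    rw [← Multiset.prod_replicate, ← Multiset.map_const']
    exact Multiset.prod_dvd_prod_of_dvd _ _ key
  obtain ⟨c, hc⟩ := hd
  rw [hc, map_mul, Matrix.aeval_self_charpoly, zero_mul]

theorem finite_ideals {K : Type*} [Field K] (P : K[X]) (hP : P ≠ 0) :
    Finite {I : Ideal K[X] // P ∈ I} := by
  have : Fintype {I : Ideal K[X] // I ∣ Ideal.span {P}} :=
    UniqueFactorizationMonoid.fintypeSubtypeDvd _ (by simpa using hP)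
  refine Finite.of_injective
    (fun I : {I : Ideal K[X] // P ∈ I} =>
      (⟨I.1, by simpa [Ideal.dvd_span_singleton] using I.2⟩ : {I : Ideal K[X] // I ∣ Ideal.span {P}})) ?_
  intro I J h
  simpa [Subtype.ext_iff] using h

theorem decomp {K : Type*} [Field K] (m : ℕ) (P : K[X]) (M : Type*) [AddCommGroup M]
    [Module K M] [Module K[X] M] [IsScalarTower K K[X] M] [Module.Finite K M]
    (hm : finrank K M = m) (hP : P ≠ 0) (hPM : ∀ x : M, P • x = 0) :
    ∃ d : Σ n : Fin (m + 1), Fin n → {I : Ideal K[X] // P ∈ I},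
      Nonempty (M ≃ₗ[K[X]] ∀ i, K[X] ⧸ (d.2 i).1) := by
  classical
  have : Module.Finite K[X] M := Module.Finite.of_restrictScalars_finite K _ _
  have ht : Module.IsTorsion K[X] M := fun x =>
    ⟨⟨P, mem_nonZeroDivisors_of_ne_zero hP⟩, hPM x⟩
  obtain ⟨ι, _, p, -, e, ⟨f⟩⟩ := Module.equiv_directSum_of_isTorsion ht
  generalize hI : (fun i => Ideal.span {p i ^ e i}) = I at *
  replace f : M ≃ₗ[K[X]] ∀ i, K[X] ⧸ I i := by
    subst hI
    exact f.trans (DirectSum.linearEquivFunOnFintype _ _ _)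
  let J := {i // I i ≠ ⊤}
  let r : (∀ i, K[X] ⧸ I i) →ₗ[K[X]] ∀ j : J, K[X] ⧸ I j.1 :=
    LinearMap.pi fun j => LinearMap.proj j.1
  have hr : Function.Bijective r := by
    constructor
    · intro a b hab
      ext i
      by_cases hi : I i = ⊤
      · have := Ideal.Quotient.subsingleton_iff.2 hi
        exact Subsingleton.elim _ _
      · exact congrFun hab ⟨i, hi⟩
    · intro b
      refine ⟨fun i => if hi : I i ≠ ⊤ then b ⟨i, hi⟩ else 0, ?_⟩
      ext j
      simp only [r, LinearMap.pi_apply, LinearMap.proj_apply]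
      exact dif_pos j.2
  let f' : M ≃ₗ[K[X]] ∀ j : J, K[X] ⧸ I j.1 := f.trans (LinearEquiv.ofBijective r hr)
  have hPI : ∀ j : J, P ∈ I j.1 := by
    intro j
    have h1 : P • (f' (f'.symm (fun _ => 1))) = 0 := by rw [← map_smul, hPM, map_zero]
    have h2 := congrFun h1 j
    rw [LinearEquiv.apply_symm_apply] at h2
    rw [← Ideal.Quotient.eq_zero_iff_mem]
    have h3 : (Ideal.Quotient.mk (I j.1)) (P * 1) = 0 := h2
    rwa [mul_one] at h3
  have hcard : Fintype.card J ≤ m := by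
    rw [← hm, ← Module.finrank_fintype_fun_eq_card K (η := J)]
    let s : (J → K) →ₗ[K] ∀ j : J, K[X] ⧸ I j.1 :=
      LinearMap.pi fun j => (Algebra.linearMap K (K[X] ⧸ I j.1)).comp (LinearMap.proj j)
    have hs : Function.Injective s := by
      intro a b hab
      ext j
      have : Nontrivial (K[X] ⧸ I j.1) := Ideal.Quotient.nontrivial_iff.2 j.2
      exact (algebraMap K (K[X] ⧸ I j.1)).injective (congrFun hab j)
    let f'' := (f'.restrictScalars K)
    exact LinearMap.finrank_le_finrank_of_injective (f := f''.symm.toLinearMap ∘ₗ s)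
      (by simpa using hs)
  let ε := Fintype.equivFin J
  exact ⟨⟨⟨Fintype.card J, Nat.lt_succ_of_le hcard⟩,
    fun i => ⟨I (ε.symm i).1, hPI _⟩⟩,
    ⟨f'.trans (LinearEquiv.piCongrLeft' K[X] (fun j : J => K[X] ⧸ I j.1) ε)⟩⟩

theorem conj_of_equiv {K : Type*} [Field K] (m : ℕ) (g h : (Matrix (Fin m) (Fin m) K)ˣ)
    (f : AEval' (Matrix.toLin' h.1) ≃ₗ[K[X]] AEval' (Matrix.toLin' g.1)) : IsConj h g := by
  let e : (Fin m → K) ≃ₗ[K] (Fin m → K) :=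
    (AEval'.of (Matrix.toLin' h.1)).trans
      ((f.restrictScalars K).trans (AEval'.of (Matrix.toLin' g.1)).symm)
  have he : ∀ v, e (Matrix.toLin' h.1 v) = Matrix.toLin' g.1 (e v) := by
    intro v
    simp only [e, LinearEquiv.trans_apply, LinearEquiv.restrictScalars_apply,
      ← AEval'.X_smul_of, map_smul]
    rw [AEval'.of_symm_X_smul]
  let c : (Matrix (Fin m) (Fin m) K)ˣ :=
    ⟨LinearMap.toMatrix' e.toLinearMap, LinearMap.toMatrix' e.symm.toLinearMap,
      by rw [← LinearMap.toMatrix'_comp]; simp, by rw [← LinearMap.toMatrix'_comp]; simp⟩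
  refine ⟨toUnits c, ?_⟩
  rw [SemiconjBy, Units.ext_iff]
  change LinearMap.toMatrix' e.toLinearMap * h.1 = g.1 * LinearMap.toMatrix' e.toLinearMap
  apply Matrix.toLin'.injective
  rw [Matrix.toLin'_mul, Matrix.toLin'_mul, Matrix.toLin'_toMatrix']
  exact LinearMap.ext he


/-- Let `K` be an algebraically closed field, `m ≥ 1`, and `q ≥ 2`.  Then the set of
conjugacy classes of elements `g ∈ GL_m(K)` with `charpoly(g^q) = charpoly(g)` is finite:
there is a finite set of such elements meeting every conjugacy class in question. -/
theorem stmt14 {K : Type*} [Field K] [IsAlgClosed K] (m : ℕ) (hm : 1 ≤ m) (q : ℕ)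
    (hq : 2 ≤ q) :
    ∃ F : Finset (Matrix (Fin m) (Fin m) K)ˣ,
      ∀ g : (Matrix (Fin m) (Fin m) K)ˣ,
        ((g : Matrix (Fin m) (Fin m) K) ^ q).charpoly =
            (g : Matrix (Fin m) (Fin m) K).charpoly →
          ∃ h ∈ F, IsConj h g := by
  classical
  have := finite_ideals (auxP K m q) (auxP_ne_zero K m q hq)
  let D := Σ n : Fin (m + 1), Fin n → {I : Ideal K[X] // auxP K m q ∈ I}
  let Q : D → (Matrix (Fin m) (Fin m) K)ˣ → Prop := fun d g =>
    Nonempty (AEval' (Matrix.toLin' g.1) ≃ₗ[K[X]] ∀ i, K[X] ⧸ (d.2 i).1)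
  have : Fintype D := Fintype.ofFinite D
  refine ⟨Finset.univ.image fun d : D => if hd : ∃ g, Q d g then hd.choose else 1, ?_⟩
  intro g hg
  have hz := aeval_auxP m q g.1 hg
  obtain ⟨d, hd⟩ := decomp m (auxP K m q) (AEval' (Matrix.toLin' g.1))
    (by rw [← (AEval'.of (Matrix.toLin' g.1)).finrank_eq]; simp) (auxP_ne_zero K m q hq) (by
      intro x
      apply (AEval'.of (Matrix.toLin' g.1)).symm.injective
      have h1 : aeval (Matrix.toLin' g.1) (auxP K m q) = 0 := by
        have := aeval_algHom_apply (Matrix.toLinAlgEquiv' (R := K) (n := Fin m)) g.1 (auxP K m q)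
        rw [hz, map_zero] at this
        exact this
      rw [AEval.of_symm_smul, h1]
      simp)
  have hex : ∃ g, Q d g := ⟨g, hd⟩
  refine ⟨hex.choose, Finset.mem_image.2 ⟨d, Finset.mem_univ _, dif_pos hex⟩, ?_⟩
  obtain ⟨f1⟩ := hex.choose_spec
  obtain ⟨f2⟩ := hd
  exact conj_of_equiv m _ _ (f1.trans f2.symm)
end
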